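/- Let ℤ₄ = ℤ/4ℤ, let Xℤ₄[X] be the additive group of polynomials over ℤ₄ with zero constant term, let H be the additive subgroup {2p(X²) − 2p(X) : p ∈ Xℤ₄[X]}, and let G = Xℤ₄[X]/H. Then the class of the polynomial X + X² in G is nonzero and satisfies 2·[X + X²] = 0, i.e. it has additive order exactly 2; moreover its image under the coefficient-reduction map to X𝔽₂[X] (which sends H to 0) is the nonzero polynomial X + X². -/

import Mathlib

open Polynomial

/-- The additive group `Xℤ₄[X]` of polynomials over `ℤ₄ = ℤ/4ℤ` with zero constant
term, as an additive subgroup of `ℤ₄[X]`. -/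
noncomputable def Xpoly4 : AddSubgroup (Polynomial (ZMod 4)) where
  carrier := {f | f.coeff 0 = 0}
  zero_mem' := by simp
  add_mem' := by
    intro a b ha hb
    simp only [Set.mem_setOf_eq, coeff_add] at *
    simp [ha, hb]
  neg_mem' := by
    intro a ha
    simp only [Set.mem_setOf_eq, coeff_neg] at *
    simp [ha]

/-- The additive subgroup `H = {2p(X²) − 2p(X) : p ∈ Xℤ₄[X]}` of `Xℤ₄[X]`, the image of
the additive homomorphism `p(X) ↦ 2p(X²) − 2p(X)`. -/
noncomputable def Hsub : AddSubgroup Xpoly4 where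
  carrier := {q | ∃ p : Polynomial (ZMod 4), p.coeff 0 = 0 ∧
    (q : Polynomial (ZMod 4)) = 2 * p.comp (X ^ 2) - 2 * p}
  zero_mem' := ⟨0, by simp⟩
  add_mem' := by
    rintro a b ⟨p, hp, hp2⟩ ⟨q, hq, hq2⟩
    refine ⟨p + q, by simp [coeff_add, hp, hq], ?_⟩
    push_cast [hp2, hq2, add_comp]
    ring
  neg_mem' := by
    rintro a ⟨p, hp, hp2⟩
    refine ⟨-p, by simp [coeff_neg, hp], ?_⟩
    push_cast [hp2, neg_comp]
    ring

/-- The quotient group `G = Xℤ₄[X]/H` of the Connolly–Davis computation. -/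
abbrev G12 : Type := Xpoly4 ⧸ Hsub

/-- The additive group `X𝔽₂[X]` of polynomials over `𝔽₂ = ℤ/2ℤ` with zero constant
term, as an additive subgroup of `𝔽₂[X]`. -/
noncomputable def XpolyF2 : AddSubgroup (Polynomial (ZMod 2)) where
  carrier := {f | f.coeff 0 = 0}
  zero_mem' := by simp
  add_mem' := by
    intro a b ha hb
    simp only [Set.mem_setOf_eq, coeff_add] at *
    simp [ha, hb]
  neg_mem' := by
    intro a ha
    simp only [Set.mem_setOf_eq, coeff_neg] at *
    simp [ha]

/-- Coefficient reduction modulo 2, from `ℤ₄[X]` to `𝔽₂[X]`. -/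
noncomputable def red42 (f : Polynomial (ZMod 4)) : Polynomial (ZMod 2) :=
  Polynomial.map (ZMod.castHom (by norm_num : (2 : ℕ) ∣ 4) (ZMod 2)) f

/-- The class of the polynomial `X + X²` in `G = Xℤ₄[X]/H`. -/
noncomputable def classXX : G12 :=
  QuotientAddGroup.mk (⟨X + X ^ 2, show (X + X ^ 2 : Polynomial (ZMod 4)).coeff 0 = 0 by simp⟩ : Xpoly4)

theorem red42_X_add_X_sq : red42 (X + X ^ 2) = X + X ^ 2 := by
  simp [red42]

theorem red42_two_mul (f : Polynomial (ZMod 4)) : red42 (2 * f) = 0 := by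
  have h : (2 : Polynomial (ZMod 2)) = 0 := CharTwo.two_eq_zero
  simp [red42, h]

theorem red42_eq_zero_of_mem_Hsub (q : Xpoly4) (hq : q ∈ Hsub) :
    red42 (q : Polynomial (ZMod 4)) = 0 := by
  obtain ⟨p, -, hp⟩ := hq
  rw [hp, ← mul_sub, red42_two_mul]

theorem X_add_X_sq_ne_zero : (X + X ^ 2 : Polynomial (ZMod 2)) ≠ 0 := by
  intro h
  have h1 := congrArg (fun f => coeff f 1) h
  simp [coeff_X_pow] at h1

/-- Coefficient reduction modulo 2 as a homomorphism `Xℤ₄[X] → X𝔽₂[X]`. -/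
noncomputable def redHom : Xpoly4 →+ XpolyF2 where
  toFun f := ⟨red42 f, by
    have hf : (f : Polynomial (ZMod 4)).coeff 0 = 0 := f.2
    change (red42 f).coeff 0 = 0
    rw [red42, coeff_map, hf, map_zero]⟩
  map_zero' := Subtype.ext (Polynomial.map_zero _)
  map_add' _ _ := Subtype.ext (Polynomial.map_add _)

theorem two_nsmul_classXX : 2 • classXX = 0 := by
  rw [classXX, ← QuotientAddGroup.mk_nsmul, QuotientAddGroup.eq_zero_iff]
  refine ⟨X, coeff_X_zero, ?_⟩
  have h : (4 : Polynomial (ZMod 4)) = 0 := CharP.cast_eq_zero (Polynomial (ZMod 4)) 4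
  simp only [AddSubgroup.coe_nsmul, nsmul_eq_mul, Nat.cast_ofNat, X_comp]
  linear_combination (X : Polynomial (ZMod 4)) * h

theorem classXX_ne_zero : classXX ≠ 0 := by
  intro h
  rw [classXX, QuotientAddGroup.eq_zero_iff] at h
  have h0 := red42_eq_zero_of_mem_Hsub _ h
  exact X_add_X_sq_ne_zero (red42_X_add_X_sq.symm.trans h0)

/-- In `G = Xℤ₄[X]/{2p(X²) − 2p(X)}`, the class of `X + X²` is nonzero and `2·[X + X²] = 0`
(so it has additive order exactly `2`); moreover coefficient reduction mod 2 kills `H`,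
hence induces a homomorphism `π : G → X𝔽₂[X]`, and `π[X + X²]` is the nonzero polynomial
`X + X²` of `X𝔽₂[X]`. -/
theorem classXX_order_two_and_reduction :
    classXX ≠ 0 ∧ 2 • classXX = 0 ∧ addOrderOf classXX = 2 ∧
    (∀ q : Xpoly4, q ∈ Hsub → red42 (q : Polynomial (ZMod 4)) = 0) ∧
    ∃ π : G12 →+ XpolyF2,
      (∀ f : Xpoly4,
        ((π (QuotientAddGroup.mk f) : XpolyF2) : Polynomial (ZMod 2)) =
          red42 (f : Polynomial (ZMod 4))) ∧
      ((π classXX : XpolyF2) : Polynomial (ZMod 2)) = X + X ^ 2 ∧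
      (X + X ^ 2 : Polynomial (ZMod 2)) ≠ 0 := by
  refine ⟨classXX_ne_zero, two_nsmul_classXX,
    addOrderOf_eq_prime two_nsmul_classXX classXX_ne_zero, red42_eq_zero_of_mem_Hsub,
    QuotientAddGroup.lift Hsub redHom
      fun q hq => Subtype.ext (red42_eq_zero_of_mem_Hsub q hq),
    fun _ => rfl, red42_X_add_X_sq, X_add_X_sq_ne_zero⟩
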